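/- Let $G$ be a bipartite graph with vertex set $\{x_1,\ldots,x_n\}$ and edge ideal $I = (u_1,\ldots,u_t,u_{t+1})$, and let $L = (u_1,\ldots,u_t) + (x_{n+1} u_{t+1})$ in $S = K[x_1,\ldots,x_n,x_{n+1}]$. Then $L$ is a normally torsion-free square-free monomial ideal, i.e., $L^k = L^{(k)}$ for all $k \ge 1$. -/

import Mathlib

open MvPolynomial

/-- `C` covers the edges of the relation `R` together with the three-element edge `{a, b, z}`. -/
def IsEdgeCover {V : Type*} (R : V → V → Prop) (a b z : V) (C : Finset V) : Prop :=
  (∀ x y, R x y → x ∈ C ∨ y ∈ C) ∧ (a ∈ C ∨ b ∈ C ∨ z ∈ C)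

section Combinatorics

variable {V : Type*} [Fintype V] [DecidableEq V] {R : V → V → Prop} {a b z : V}

/-- Uncrossing: two covers can be replaced by a pair of covers of no larger total weight, one of
which contains the common left vertices and all right vertices of both. -/
theorem exists_isEdgeCover_uncross {c : V → Prop} (hR : ∀ x y, R x y → c x ∧ ¬c y ∧ x ≠ z ∧ y ≠ z)
    (ha : c a) (hb : ¬c b) (haz : a ≠ z) (hbz : b ≠ z) (w : V → ℕ) {C D : Finset V}
    (hC : IsEdgeCover R a b z C) (hD : IsEdgeCover R a b z D) :
    ∃ J M : Finset V, IsEdgeCover R a b z J ∧ IsEdgeCover R a b z M ∧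
      ∑ v ∈ J, w v + ∑ v ∈ M, w v ≤ ∑ v ∈ C, w v + ∑ v ∈ D, w v ∧
      (∀ v, v ≠ z → c v → v ∈ C → v ∈ D → v ∈ M) ∧
      (∀ v, v ≠ z → ¬c v → v ∈ C ∨ v ∈ D → v ∈ M) := by
  classical
  refine ⟨Finset.univ.filter fun v => if v = z then (z ∈ C ∨ z ∈ D) ∧ a ∉ C ∧ a ∉ D ∧
      ¬(b ∈ C ∧ b ∈ D) else if c v then v ∈ C ∨ v ∈ D else v ∈ C ∧ v ∈ D,
    Finset.univ.filter fun v => if v = z then (z ∈ C ∨ z ∈ D) ∧ ¬(a ∈ C ∧ a ∈ D) ∧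
      b ∉ C ∧ b ∉ D else if c v then v ∈ C ∧ v ∈ D else v ∈ C ∨ v ∈ D, ?_, ?_, ?_, ?_, ?_⟩
  · obtain ⟨hC, hC'⟩ := hC
    obtain ⟨hD, hD'⟩ := hD
    refine ⟨fun x y h => ?_, ?_⟩
    · obtain ⟨h1, h2, h3, h4⟩ := hR x y h
      have := hC x y h
      have := hD x y h
      simp only [Finset.mem_filter, Finset.mem_univ, true_and, h1, h2, h3, h4, if_true, if_false]
      tauto
    · simp only [Finset.mem_filter, Finset.mem_univ, true_and, ha, hb, haz, hbz, if_true, if_false]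
      tauto
  · obtain ⟨hC, hC'⟩ := hC
    obtain ⟨hD, hD'⟩ := hD
    refine ⟨fun x y h => ?_, ?_⟩
    · obtain ⟨h1, h2, h3, h4⟩ := hR x y h
      have := hC x y h
      have := hD x y h
      simp only [Finset.mem_filter, Finset.mem_univ, true_and, h1, h2, h3, h4, if_true, if_false]
      tauto
    · simp only [Finset.mem_filter, Finset.mem_univ, true_and, ha, hb, haz, hbz, if_true, if_false]
      tauto
  · have key (S : Finset V) : ∑ v ∈ S, w v = ∑ v, if v ∈ S then w v else 0 := by simp
    rw [key, key, key C, key D, ← Finset.sum_add_distrib, ← Finset.sum_add_distrib]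
    refine Finset.sum_le_sum fun v _ => ?_
    simp only [Finset.mem_filter, Finset.mem_univ, true_and]
    have := hC.2
    have := hD.2
    by_cases hv : v = z
    · subst hv
      simp only [if_true]
      grind
    · simp only [hv, if_false]
      grind
  · intro v h1 h2 h3 h4
    simp [h1, h2, h3, h4]
  · intro v h1 h2 h3
    simp [h1, h2, h3]

/-- If every cover has weight at least `k + 1`, then some vertex can be lowered without violating
this bound, or some edge can be removed from the weight leaving every cover of weight at least
`k`. -/
theorem exists_edge_or_vertex_of_le_sum {c : V → Prop}
    (hR : ∀ x y, R x y → c x ∧ ¬c y ∧ x ≠ z ∧ y ≠ z)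
    (ha : c a) (hb : ¬c b) (haz : a ≠ z) (hbz : b ≠ z) (w : V → ℕ) (k : ℕ)
    (hw : ∀ C, IsEdgeCover R a b z C → k + 1 ≤ ∑ v ∈ C, w v) :
    (∃ x, 0 < w x ∧ ∀ C, IsEdgeCover R a b z C →
      k + 1 + (if x ∈ C then 1 else 0) ≤ ∑ v ∈ C, w v) ∨
    (∃ x y, R x y ∧ 0 < w x ∧ 0 < w y ∧ ∀ C, IsEdgeCover R a b z C →
      k + ((if x ∈ C then 1 else 0) + (if y ∈ C then 1 else 0)) ≤ ∑ v ∈ C, w v) ∨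
    (0 < w a ∧ 0 < w b ∧ 0 < w z ∧ ∀ C, IsEdgeCover R a b z C →
      k + ((if a ∈ C then 1 else 0) + (if b ∈ C then 1 else 0) + (if z ∈ C then 1 else 0))
        ≤ ∑ v ∈ C, w v) := by
  classical
  obtain ⟨x, hxc, hxz, hx⟩ : ∃ x, c x ∧ x ≠ z ∧ 0 < w x := by
    by_contra! h
    have h1 : IsEdgeCover R a b z (Finset.univ.filter fun v => c v ∧ v ≠ z) :=
      ⟨fun x y h => Or.inl (by simp [(hR x y h).1, (hR x y h).2.2.1]), Or.inl (by simp [ha, haz])⟩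
    have h2 := hw _ h1
    rw [Finset.sum_eq_zero] at h2
    · omega
    · intro v hv
      simp only [Finset.mem_filter, Finset.mem_univ, true_and] at hv
      have := h v hv.1 hv.2
      omega
  by_cases hT : ∀ C, IsEdgeCover R a b z C → x ∈ C → ∑ v ∈ C, w v ≠ k + 1
  · refine Or.inl ⟨x, hx, fun C hC => ?_⟩
    have := hw C hC
    have := hT C hC
    split_ifs with h
    · have := this h
      omega
    · omega
  right
  push Not at hT
  obtain ⟨C₀, hC₀⟩ := hT
  obtain ⟨C, hC, hmax⟩ := Finset.exists_max_image
    (Finset.univ.filter fun C => IsEdgeCover R a b z C ∧ x ∈ C ∧ ∑ v ∈ C, w v = k + 1)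
    (fun C => (C.filter fun v => v ≠ z ∧ ¬c v).card) ⟨C₀, by simpa using hC₀⟩
  simp only [Finset.mem_filter, Finset.mem_univ, true_and] at hC hmax
  obtain ⟨hC, hxC, hCw⟩ := hC
  -- every tight cover through `x` has its right part inside `C`
  have hsub : ∀ D, IsEdgeCover R a b z D → x ∈ D → ∑ v ∈ D, w v = k + 1 →
      ∀ y, y ≠ z → ¬c y → y ∈ D → y ∈ C := by
    intro D hD hxD hDw y hyz hyc hyD
    by_contra hyC
    obtain ⟨J, M, hJ, hM, hle, hMl, hMr⟩ :=
      exists_isEdgeCover_uncross hR ha hb haz hbz w hC hD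
    have h1 := hw J hJ
    have h2 := hw M hM
    have h3 := hmax M ⟨hM, hMl x hxz hxc hxC hxD, by omega⟩
    refine absurd h3 (not_le.mpr (Finset.card_lt_card ?_))
    refine (Finset.ssubset_iff_of_subset fun v hv => ?_).mpr
      ⟨y, by simp [hyz, hyc, hMr y hyz hyc (Or.inr hyD)], by simp [hyC]⟩
    simp only [Finset.mem_filter] at hv ⊢
    exact ⟨hMr v hv.2.1 hv.2.2 (Or.inl hv.1), hv.2⟩
  -- a tight cover through `x` with all weightless vertices added
  set E := C ∪ Finset.univ.filter fun v => w v = 0 with hE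
  have hEw : ∑ v ∈ E, w v = k + 1 := by
    rw [← hCw]
    refine (Finset.sum_subset Finset.subset_union_left fun v hv hv' => ?_).symm
    simpa [hE, hv'] using hv
  have hpos : ∀ v, v ∉ E → 0 < w v := by
    intro v hv
    simp only [hE, Finset.mem_union, Finset.mem_filter, Finset.mem_univ, true_and, not_or] at hv
    omega
  have hnot : ∀ v, v ∉ E → v ∉ C := fun v hv h => hv (Finset.mem_union_left _ h)
  have hncov : ¬IsEdgeCover R a b z (E.erase x) := by
    intro h
    have h1 := hw _ h
    have h2 := Finset.add_sum_erase E w (Finset.mem_union_left _ hxC)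
    omega
  have hcovE : IsEdgeCover R a b z E :=
    ⟨fun u v h => (hC.1 u v h).imp (Finset.mem_union_left _) (Finset.mem_union_left _),
      hC.2.imp (Finset.mem_union_left _) (Or.imp (Finset.mem_union_left _)
        (Finset.mem_union_left _))⟩
  by_cases hedge : ∀ u v, R u v → u ∈ E.erase x ∨ v ∈ E.erase x
  · right
    have h3 : ¬(a ∈ E.erase x ∨ b ∈ E.erase x ∨ z ∈ E.erase x) := fun h => hncov ⟨hedge, h⟩
    have hbx : b ≠ x := fun h => hb (h ▸ hxc)
    simp only [Finset.mem_erase, hbx, hxz.symm, ne_eq, not_false_eq_true, true_and, not_or] at h3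
    have hax : a = x := by
      by_contra h
      have := hcovE.2
      tauto
    subst hax
    have hwz := hpos z h3.2.2
    refine ⟨hx, hpos b h3.2.1, hwz, fun D hD => ?_⟩
    have h4 := hw D hD
    have h6 := hnot b h3.2.1
    have h7 := fun p q => hsub D hD p q b hbz hb
    by_cases hzD : z ∈ D
    · have h8 := Finset.add_sum_erase D w hzD
      by_cases hab : a ∈ D ∨ b ∈ D
      · have h9 : IsEdgeCover R a b z (D.erase z) := by
          refine ⟨fun u v h => ?_, ?_⟩
          · simpa [(hR u v h).2.2.1, (hR u v h).2.2.2] using hD.1 u v h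
          · simp only [Finset.mem_erase, haz, hbz, ne_eq, not_false_eq_true, true_and]
            tauto
        have h10 := hw _ h9
        have h12 := fun p q => hsub _ h9 p q b hbz hb
        simp only [Finset.mem_erase, haz, hbz, ne_eq, not_false_eq_true, true_and] at h12
        grind
      · grind
    · grind
  · left
    push Not at hedge
    obtain ⟨u, v, huv, hu, hv⟩ := hedge
    obtain ⟨h1, h2, h3, h4⟩ := hR u v huv
    have hvx : v ≠ x := fun h => h2 (h ▸ hxc)
    simp only [Finset.mem_erase, hvx, ne_eq, not_false_eq_true, true_and] at hu hv
    have hux : u = x := by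
      by_contra h
      have := hcovE.1 u v huv
      tauto
    subst hux
    refine ⟨u, v, huv, hx, hpos v hv, fun D hD => ?_⟩
    have h5 := hw D hD
    have h6 := fun p q => hsub D hD p q v h4 h2
    have h7 := hnot v hv
    grind

theorem monomial_mem_pow_of_le_sum {K : Type*} [CommSemiring K] {c : V → Prop}
    (hR : ∀ x y, R x y → c x ∧ ¬c y ∧ x ≠ z ∧ y ≠ z)
    (ha : c a) (hb : ¬c b) (haz : a ≠ z) (hbz : b ≠ z) (I : Ideal (MvPolynomial V K))
    (hI : ∀ x y, R x y → X x * X y ∈ I) (hI' : X z * X a * X b ∈ I) (w : V →₀ ℕ) (k : ℕ)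
    (hw : ∀ C, IsEdgeCover R a b z C → k ≤ ∑ v ∈ C, w v) :
    monomial w (1 : K) ∈ I ^ k := by
  have hsum (C : Finset V) (x : V) :
      ∑ v ∈ C, Finsupp.single x 1 v = if x ∈ C then 1 else 0 := by
    simp [Finsupp.single_apply]
  have hsplit (s t : V →₀ ℕ) : monomial (s + t) (1 : K) = monomial s 1 * monomial t 1 := by
    simp [monomial_mul]
  induction hN : w.degree using Nat.strong_induction_on generalizing w k with
  | _ N ih =>
  subst hN
  obtain _ | k := k
  · simp
  obtain ⟨x, hx, h⟩ | ⟨x, y, hxy, hx, hy, h⟩ | ⟨h1, h2, h3, h⟩ :=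
    exists_edge_or_vertex_of_le_sum hR ha hb haz hbz w k hw
  · obtain ⟨u, rfl⟩ : ∃ u, w = Finsupp.single x 1 + u :=
      exists_add_of_le (by rw [Finsupp.single_le_iff]; exact hx)
    rw [hsplit]
    refine Ideal.mul_mem_left _ _ (ih u.degree (by simp) u _ (fun C hC => ?_) rfl)
    have := h C hC
    simp only [Finsupp.add_apply, Finset.sum_add_distrib, hsum] at this
    omega
  · have hne : x ≠ y := fun e => (hR x y hxy).2.1 (e ▸ (hR x y hxy).1)
    obtain ⟨u, rfl⟩ : ∃ u, w = Finsupp.single x 1 + Finsupp.single y 1 + u := by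
      refine exists_add_of_le fun v => ?_
      simp only [Finsupp.add_apply, Finsupp.single_apply]
      grind
    rw [hsplit, pow_succ', hsplit]
    refine Ideal.mul_mem_mul (hI x y hxy)
      (ih u.degree (by simp) u _ (fun C hC => ?_) rfl)
    have := h C hC
    simp only [Finsupp.add_apply, Finset.sum_add_distrib, hsum] at this
    omega
  · have hne : a ≠ b := fun e => hb (e ▸ ha)
    obtain ⟨u, rfl⟩ :
        ∃ u, w = Finsupp.single z 1 + Finsupp.single a 1 + Finsupp.single b 1 + u := by
      refine exists_add_of_le fun v => ?_
      simp only [Finsupp.add_apply, Finsupp.single_apply]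
      grind
    rw [hsplit, pow_succ', hsplit, hsplit]
    refine Ideal.mul_mem_mul hI' (ih u.degree (by simp) u _ (fun C hC => ?_) rfl)
    have := h C hC
    simp only [Finsupp.add_apply, Finset.sum_add_distrib, hsum] at this
    omega

end Combinatorics

section VariableIdeals

variable {σ K : Type*}

theorem isPrime_span_X_image [CommRing K] [IsDomain K] (s : Set σ) :
    (Ideal.span (X '' s : Set (MvPolynomial σ K))).IsPrime := by
  classical
  set P := Ideal.span (X '' s : Set (MvPolynomial σ K))
  let φ : MvPolynomial σ K →ₐ[K] MvPolynomial σ K := aeval fun i => if i ∈ s then 0 else X i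
  have hφ : (Ideal.Quotient.mkₐ K P).comp φ = Ideal.Quotient.mkₐ K P := by
    ext i
    by_cases h : i ∈ s
    · simpa [φ, h] using
        (Ideal.Quotient.eq_zero_iff_mem.mpr
          (Ideal.subset_span (Set.mem_image_of_mem X h) : (X i : MvPolynomial σ K) ∈ P)).symm
    · simp [φ, h]
  have hker : RingHom.ker φ = P := by
    refine le_antisymm (fun f hf => ?_) (Ideal.span_le.mpr ?_)
    · have := DFunLike.congr_fun hφ f
      rw [AlgHom.comp_apply, (RingHom.mem_ker).mp hf, map_zero] at this
      exact Ideal.Quotient.eq_zero_iff_mem.mp this.symm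
    · rintro _ ⟨i, hi, rfl⟩
      simp [φ, hi, RingHom.mem_ker]
  exact hker ▸ RingHom.ker_isPrime φ

theorem le_sum_of_mem_span_X_image_pow [CommSemiring K] (C : Finset σ) (k : ℕ)
    {f : MvPolynomial σ K} (hf : f ∈ Ideal.span (X '' (C : Set σ) : Set (MvPolynomial σ K)) ^ k)
    {m : σ →₀ ℕ} (hm : m ∈ f.support) : k ≤ ∑ v ∈ C, m v := by
  classical
  induction k generalizing f m with
  | zero => simp
  | succ k ih =>
    rw [pow_succ] at hf
    induction hf using Submodule.mul_induction_on' generalizing m with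
    | mem_mul_mem p hp q hq =>
      obtain ⟨s, hs, t, ht, rfl⟩ := Finset.mem_add.mp (support_mul p q hm)
      obtain ⟨i, hi, hti⟩ := mem_ideal_span_X_image.mp hq t ht
      have h1 := ih hp hs
      have h2 := Finset.single_le_sum (f := fun v => t v) (fun _ _ => Nat.zero_le _) hi
      simp only [Finsupp.add_apply, Finset.sum_add_distrib]
      omega
    | add p _ q _ hp hq =>
      exact (Finset.mem_union.mp (support_add hm)).elim hp hq

end VariableIdeals

/-- For a bipartite graph `G` on `x₁,…,xₙ` with edge ideal
`I = (u₁,…,u_t,u_{t+1})` (with `u_{t+1} = x_α x_β`), the ideal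
`L = (u₁,…,u_t) + (x_{n+1} u_{t+1})` in `K[x₁,…,x_{n+1}]` is normally torsion-free,
i.e. `L^k = L^{(k)} = ⋂_{𝔭 ∈ Min L} 𝔭^k` for all `k ≥ 1`. -/
theorem stmt18 {n : ℕ} {K : Type*} [Field K]
    (G : SimpleGraph (Fin n))
    (hbip : ∃ c : Fin n → Bool, ∀ a b, G.Adj a b → c a ≠ c b)
    (α β : Fin n) (hadj : G.Adj α β)
    (L : Ideal (MvPolynomial (Fin (n + 1)) K))
    (hL : L = Ideal.span {m : MvPolynomial (Fin (n + 1)) K |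
        ∃ a b, G.Adj a b ∧ ¬((a = α ∧ b = β) ∨ (a = β ∧ b = α)) ∧
          m = X a.castSucc * X b.castSucc}
      + Ideal.span {(X (Fin.last n) * X α.castSucc * X β.castSucc :
          MvPolynomial (Fin (n + 1)) K)}) :
    ∀ k : ℕ, 1 ≤ k → L ^ k = ⨅ p ∈ L.minimalPrimes, p ^ k := by
  intro k _
  refine le_antisymm (le_iInf₂ fun p hp => Ideal.pow_right_mono hp.1.2 k) fun f hf => ?_
  obtain ⟨c, hc⟩ := hbip
  let d : Fin (n + 1) → Prop := fun v => ∃ a : Fin n, v = a.castSucc ∧ c a = c α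
  let R : Fin (n + 1) → Fin (n + 1) → Prop := fun x y => ∃ a b : Fin n, x = a.castSucc ∧
    y = b.castSucc ∧ c a = c α ∧ G.Adj a b ∧ ¬((a = α ∧ b = β) ∨ (a = β ∧ b = α))
  have hd (a : Fin n) : d a.castSucc ↔ c a = c α := by
    simp [d]
  have hR : ∀ x y, R x y → d x ∧ ¬d y ∧ x ≠ Fin.last n ∧ y ≠ Fin.last n := by
    rintro _ _ ⟨a, b, rfl, rfl, ha, hab, -⟩
    refine ⟨(hd a).mpr ha, fun h => hc a b hab (ha.trans ((hd b).mp h).symm),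
      Fin.castSucc_ne_last a, Fin.castSucc_ne_last b⟩
  have hmem : ∀ a b, G.Adj a b → ¬((a = α ∧ b = β) ∨ (a = β ∧ b = α)) →
      (X a.castSucc * X b.castSucc : MvPolynomial (Fin (n + 1)) K) ∈ L := fun a b h h' =>
    hL ▸ Ideal.mem_sup_left (Ideal.subset_span ⟨a, b, h, h', rfl⟩)
  have hcover : ∀ C, IsEdgeCover R α.castSucc β.castSucc (Fin.last n) C →
      f ∈ Ideal.span (X '' (C : Set (Fin (n + 1))) : Set (MvPolynomial (Fin (n + 1)) K)) ^ k := by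
    intro C hC
    have := isPrime_span_X_image (K := K) (C : Set (Fin (n + 1)))
    have hX : ∀ v ∈ C, (X v : MvPolynomial (Fin (n + 1)) K) ∈
        Ideal.span (X '' (C : Set (Fin (n + 1)))) := fun v hv => Ideal.subset_span ⟨v, hv, rfl⟩
    have hle : L ≤ Ideal.span (X '' (C : Set (Fin (n + 1)))) := by
      rw [hL]
      refine sup_le (Ideal.span_le.mpr ?_) (Ideal.span_le.mpr ?_)
      · rintro _ ⟨a, b, hab, hne, rfl⟩
        have hcover : a.castSucc ∈ C ∨ b.castSucc ∈ C := by
          by_cases h : c a = c α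
          · exact hC.1 _ _ ⟨a, b, rfl, rfl, h, hab, hne⟩
          · have h' : c b = c α := by
              have := hc a b hab
              revert h this
              cases c a <;> cases c b <;> cases c α <;> simp
            exact (hC.1 _ _ ⟨b, a, rfl, rfl, h', hab.symm, by tauto⟩).symm
        exact hcover.elim (fun h => Ideal.mul_mem_right _ _ (hX _ h))
          (fun h => Ideal.mul_mem_left _ _ (hX _ h))
      · rintro _ rfl
        obtain h | h | h := hC.2
        · exact Ideal.mul_mem_right _ _ (Ideal.mul_mem_left _ _ (hX _ h))
        · exact Ideal.mul_mem_left _ _ (hX _ h)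
        · exact Ideal.mul_mem_right _ _ (Ideal.mul_mem_right _ _ (hX _ h))
    obtain ⟨p, hp, hpC⟩ := Ideal.exists_minimalPrimes_le hle
    exact Ideal.pow_right_mono hpC k
      (Submodule.mem_iInf _ |>.mp (Submodule.mem_iInf _ |>.mp hf p) hp)
  rw [f.as_sum]
  refine Ideal.sum_mem _ fun m hm => ?_
  rw [← mul_one (coeff m f), ← C_mul_monomial]
  refine Ideal.mul_mem_left _ _ (monomial_mem_pow_of_le_sum hR ((hd α).mpr rfl)
    (fun h => hc α β hadj ((hd β).mp h).symm) (Fin.castSucc_ne_last α) (Fin.castSucc_ne_last β)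
    L ?_ ?_ m k fun C hC => le_sum_of_mem_span_X_image_pow C k (hcover C hC) hm)
  · rintro _ _ ⟨a, b, rfl, rfl, -, hab, hne⟩
    exact hmem a b hab hne
  · exact hL ▸ Ideal.mem_sup_right (Ideal.mem_span_singleton_self _)
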